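/- arXiv:1701.07570 — 11 statements merged into one kernel-verified Lean document; each statement's English description precedes it below -/
import Mathlib

section
/- For every partition of {1,…,T} into consecutive intervals I_1=[s_1,q_1], …, I_k=[s_k,q_k], the worst-case dynamic regret satisfies DReg* ≤ Σ_{i=1}^k ( SAReg(T, |I_i|) + 2·|I_i|·V(s_i, q_i) ). -/
/-- Local functional variation of `f` over the interval `[s, q]`:
`V(s,q) = ∑_{t=s+1}^{q} max_{w ∈ Ω} |f_t(w) − f_{t−1}(w)|`. -/
noncomputable def locVar {E : Type*} [NormedAddCommGroup E] [NormedSpace ℝ E]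
    (Ω : Set E) (f : ℕ → E → ℝ) (s q : ℕ) : ℝ :=
  ∑ t ∈ Finset.Icc (s + 1) q, sSup ((fun x => |f t x - f (t - 1) x|) '' Ω)

/-- Static regret of the decisions `w` over the interval `[s, q]`. -/
noncomputable def statReg {E : Type*} [NormedAddCommGroup E] [NormedSpace ℝ E]
    (Ω : Set E) (f : ℕ → E → ℝ) (w : ℕ → E) (s q : ℕ) : ℝ :=
  (∑ t ∈ Finset.Icc s q, f t (w t)) - sInf ((fun x => ∑ t ∈ Finset.Icc s q, f t x) '' Ω)

/-- Strongly adaptive regret at scale `τ`: the maximum of the static regret over all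
intervals `[s, s+τ−1] ⊆ [1, T]`. -/
noncomputable def SAReg {E : Type*} [NormedAddCommGroup E] [NormedSpace ℝ E]
    (Ω : Set E) (f : ℕ → E → ℝ) (w : ℕ → E) (T τ : ℕ) : ℝ :=
  sSup ((fun s => statReg Ω f w s (s + τ - 1)) '' Set.Icc 1 (T - τ + 1))

/-- Worst-case dynamic regret over `T` rounds. -/
noncomputable def DRegStar {E : Type*} [NormedAddCommGroup E] [NormedSpace ℝ E]
    (Ω : Set E) (f : ℕ → E → ℝ) (w : ℕ → E) (T : ℕ) : ℝ :=
  (∑ t ∈ Finset.Icc 1 T, f t (w t)) - ∑ t ∈ Finset.Icc 1 T, sInf ((f t) '' Ω)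

lemma sum_partition_aux (k : ℕ) (s q : ℕ → ℕ) (hs1 : s 1 = 1)
    (hcons : ∀ i ∈ Finset.Icc 1 (k - 1), q i + 1 = s (i + 1))
    (hle : ∀ i ∈ Finset.Icc 1 k, s i ≤ q i) (g : ℕ → ℝ) (j : ℕ) (hj : 1 ≤ j) (hjk : j ≤ k) :
    1 ≤ s j ∧ ∑ t ∈ Finset.Icc 1 (q j), g t
      = ∑ i ∈ Finset.Icc 1 j, ∑ t ∈ Finset.Icc (s i) (q i), g t := by
  induction j, hj using Nat.le_induction with
  | base => simp [hs1]
  | succ j hj ih =>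
    obtain ⟨h1, h2⟩ := ih (by omega)
    have hc := hcons j (Finset.mem_Icc.2 ⟨hj, by omega⟩)
    have hl := hle (j + 1) (Finset.mem_Icc.2 ⟨by omega, hjk⟩)
    refine ⟨by omega, ?_⟩
    rw [Finset.sum_Icc_succ_top (by omega : 1 ≤ j + 1), ← h2, ← hc]
    have e : Finset.Icc 1 (q (j + 1))
        = Finset.Icc 1 (q j) ∪ Finset.Icc (q j + 1) (q (j + 1)) := by
      ext t
      simp only [Finset.mem_Icc, Finset.mem_union]
      omega
    rw [e, Finset.sum_union]
    rw [Finset.disjoint_left]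
    intro t
    simp only [Finset.mem_Icc]
    omega

lemma q_le_aux (k : ℕ) (s q : ℕ → ℕ)
    (hcons : ∀ i ∈ Finset.Icc 1 (k - 1), q i + 1 = s (i + 1))
    (hle : ∀ i ∈ Finset.Icc 1 k, s i ≤ q i) (i : ℕ) (hi : 1 ≤ i) (j : ℕ) (hij : i ≤ j)
    (hjk : j ≤ k) : q i ≤ q j := by
  induction j, hij using Nat.le_induction with
  | base => exact le_rfl
  | succ j hj ih =>
    have h1 := ih (by omega)
    have hc := hcons j (Finset.mem_Icc.2 ⟨by omega, by omega⟩)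
    have hl := hle (j + 1) (Finset.mem_Icc.2 ⟨by omega, hjk⟩)
    omega

lemma abs_sub_le_locVar_aux {E : Type*} [NormedAddCommGroup E] [NormedSpace ℝ E]
    (T : ℕ) (Ω : Set E) (hΩ : IsCompact Ω)
    (f : ℕ → E → ℝ) (hf : ∀ t ∈ Finset.Icc 1 T, ContinuousOn (f t) Ω)
    (a b : ℕ) (ha : 1 ≤ a) (hb : b ≤ T) (x : E) (hx : x ∈ Ω) (t : ℕ) (hat : a ≤ t) (htb : t ≤ b) :
    |f t x - f a x| ≤ locVar Ω f a b := by
  have key : |f t x - f a x| ≤ locVar Ω f a t := by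
    induction t, hat using Nat.le_induction with
    | base => simp [locVar]
    | succ t ht ih =>
      have h1 := ih (by omega)
      have h2 : |f (t + 1) x - f t x|
          ≤ sSup ((fun x => |f (t + 1) x - f (t + 1 - 1) x|) '' Ω) := by
        apply le_csSup
        · apply IsCompact.bddAbove
          apply hΩ.image_of_continuousOn
          exact ((hf (t + 1) (Finset.mem_Icc.2 ⟨by omega, by omega⟩)).sub
            (hf (t + 1 - 1) (Finset.mem_Icc.2 ⟨by omega, by omega⟩))).abs
        · exact ⟨x, hx, rfl⟩
      have h3 : locVar Ω f a (t + 1) = locVar Ω f a t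
          + sSup ((fun x => |f (t + 1) x - f (t + 1 - 1) x|) '' Ω) := by
        unfold locVar
        rw [Finset.sum_Icc_succ_top (by omega : a + 1 ≤ t + 1)]
      have h4 := abs_sub_le (f (t + 1) x) (f t x) (f a x)
      linarith
  refine key.trans ?_
  unfold locVar
  apply Finset.sum_le_sum_of_subset_of_nonneg
  · exact Finset.Icc_subset_Icc le_rfl htb
  · intro i _ _
    apply Real.sSup_nonneg
    rintro _ ⟨y, _, rfl⟩
    exact abs_nonneg _

lemma interval_aux {E : Type*} [NormedAddCommGroup E] [NormedSpace ℝ E]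
    (T : ℕ) (Ω : Set E) (hΩne : Ω.Nonempty) (hΩ : IsCompact Ω)
    (f : ℕ → E → ℝ) (hf : ∀ t ∈ Finset.Icc 1 T, ContinuousOn (f t) Ω)
    (w : ℕ → E) (a b : ℕ) (ha : 1 ≤ a) (hab : a ≤ b) (hb : b ≤ T) :
    ∑ t ∈ Finset.Icc a b, (f t (w t) - sInf ((f t) '' Ω)) ≤
      SAReg Ω f w T (b - a + 1) + 2 * ((b - a + 1 : ℕ) : ℝ) * locVar Ω f a b := by
  have hc : ∀ t ∈ Finset.Icc a b, ContinuousOn (f t) Ω := by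
    intro t ht
    rw [Finset.mem_Icc] at ht
    exact hf t (Finset.mem_Icc.2 ⟨by omega, by omega⟩)
  obtain ⟨x, hx, hmin⟩ := hΩ.exists_isMinOn hΩne (hc a (Finset.mem_Icc.2 ⟨le_rfl, hab⟩))
  have h1 : ∀ t ∈ Finset.Icc a b, f t x ≤ sInf ((f t) '' Ω) + 2 * locVar Ω f a b := by
    intro t ht
    rw [Finset.mem_Icc] at ht
    rw [← sub_le_iff_le_add]
    apply le_csInf (hΩne.image _)
    rintro _ ⟨y, hy, rfl⟩
    have e1 := abs_le.1 (abs_sub_le_locVar_aux T Ω hΩ f hf a b ha hb x hx t ht.1 ht.2)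
    have e2 := abs_le.1 (abs_sub_le_locVar_aux T Ω hΩ f hf a b ha hb y hy t ht.1 ht.2)
    have e3 : f a x ≤ f a y := hmin hy
    linarith [e1.2, e2.1]
  have h2 := Finset.sum_le_sum h1
  rw [Finset.sum_add_distrib, Finset.sum_const, Nat.card_Icc, nsmul_eq_mul,
    show b + 1 - a = b - a + 1 by omega] at h2
  have h3 : sInf ((fun x => ∑ t ∈ Finset.Icc a b, f t x) '' Ω) ≤ ∑ t ∈ Finset.Icc a b, f t x := by
    apply csInf_le
    · apply IsCompact.bddBelow
      exact hΩ.image_of_continuousOn (continuousOn_finset_sum _ hc)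
    · exact ⟨x, hx, rfl⟩
  have h4 : statReg Ω f w a b ≤ SAReg Ω f w T (b - a + 1) := by
    apply le_csSup
    · exact ((Set.finite_Icc _ _).image _).bddAbove
    · refine ⟨a, ⟨ha, by omega⟩, ?_⟩
      show statReg Ω f w a (a + (b - a + 1) - 1) = _
      rw [show a + (b - a + 1) - 1 = b by omega]
  unfold statReg at h4
  rw [Finset.sum_sub_distrib]
  linarith

/-- For every partition of `[1,T]` into consecutive intervals `I_i = [s_i, q_i]`,
`DReg* ≤ ∑_i ( SAReg(T, |I_i|) + 2 |I_i| V(s_i, q_i) )`. -/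
theorem dynamic_regret_le_adaptive_regret
    {E : Type*} [NormedAddCommGroup E] [NormedSpace ℝ E]
    (T : ℕ) (hT : 1 ≤ T) (Ω : Set E) (hΩne : Ω.Nonempty) (hΩ : IsCompact Ω)
    (f : ℕ → E → ℝ) (hf : ∀ t ∈ Finset.Icc 1 T, ContinuousOn (f t) Ω)
    (w : ℕ → E) (hw : ∀ t ∈ Finset.Icc 1 T, w t ∈ Ω)
    (k : ℕ) (hk : 1 ≤ k) (s q : ℕ → ℕ)
    (hs1 : s 1 = 1) (hqk : q k = T)
    (hcons : ∀ i ∈ Finset.Icc 1 (k - 1), q i + 1 = s (i + 1))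
    (hle : ∀ i ∈ Finset.Icc 1 k, s i ≤ q i) :
    DRegStar Ω f w T ≤
      ∑ i ∈ Finset.Icc 1 k,
        (SAReg Ω f w T (q i - s i + 1) +
          2 * ((q i - s i + 1 : ℕ) : ℝ) * locVar Ω f (s i) (q i)) := by
  have hp := (sum_partition_aux k s q hs1 hcons hle
    (fun t => f t (w t) - sInf ((f t) '' Ω)) k hk le_rfl).2
  rw [hqk] at hp
  unfold DRegStar
  rw [← Finset.sum_sub_distrib, hp]
  apply Finset.sum_le_sum
  intro i hi
  have hi' := Finset.mem_Icc.1 hi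
  have hs := (sum_partition_aux k s q hs1 hcons hle (fun _ => 0) i hi'.1 hi'.2).1
  have hq := q_le_aux k s q hcons hle i hi'.1 k hi'.2 le_rfl
  exact interval_aux T Ω hΩne hΩ f hf w (s i) (q i) hs (hle i hi) (hqk ▸ hq)
end

section
/- For every partition of {1,…,T} into consecutive intervals I_1=[s_1,q_1], …, I_k=[s_k,q_k], the worst-case dynamic regret satisfies DReg* ≤ Σ_{i=1}^k [ ( Σ_{t=s_i}^{q_i} f_t(w_t) − min_{w∈Ω} Σ_{t=s_i}^{q_i} f_t(w) ) + 2·|I_i|·V(s_i, q_i) ], where the first summand is the static regret of the sequence w_t on the interval I_i itself. -/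
lemma locVar_drift {E : Type*} [NormedAddCommGroup E] [NormedSpace ℝ E]
    (T : ℕ) (Ω : Set E) (hΩ : IsCompact Ω)
    (f : ℕ → E → ℝ) (hf : ∀ t ∈ Finset.Icc 1 T, ContinuousOn (f t) Ω)
    (s : ℕ) (hs : 1 ≤ s) (y : E) (hy : y ∈ Ω) (t : ℕ) (hst : s ≤ t) :
    t ≤ T → |f t y - f s y| ≤ locVar Ω f s t := by
  induction t, hst using Nat.le_induction with
  | base => intro _; simp [locVar]
  | succ n hn ih =>
    intro hT
    have h1 := ih (by omega)
    have hc1 := hf n (Finset.mem_Icc.2 ⟨by omega, by omega⟩)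
    have hc2 := hf (n + 1) (Finset.mem_Icc.2 ⟨by omega, by omega⟩)
    have hb : BddAbove ((fun x => |f (n + 1) x - f (n + 1 - 1) x|) '' Ω) := by
      apply (hΩ.image_of_continuousOn _).bddAbove
      exact (hc2.sub hc1).abs
    have h2 : |f (n + 1) y - f (n + 1 - 1) y| ≤
        sSup ((fun x => |f (n + 1) x - f (n + 1 - 1) x|) '' Ω) :=
      le_csSup hb ⟨y, hy, rfl⟩
    have h3 : locVar Ω f s (n + 1) = locVar Ω f s n +
        sSup ((fun x => |f (n + 1) x - f (n + 1 - 1) x|) '' Ω) := by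
      unfold locVar
      rw [Finset.sum_Icc_succ_top (by omega)]
    have h4 := abs_sub_le (f (n + 1) y) (f n y) (f s y)
    rw [h3]
    simp only [Nat.add_sub_cancel] at h2 ⊢
    linarith

lemma locVar_mono {E : Type*} [NormedAddCommGroup E] [NormedSpace ℝ E]
    (Ω : Set E) (f : ℕ → E → ℝ) (s t q : ℕ) (h : t ≤ q) :
    locVar Ω f s t ≤ locVar Ω f s q := by
  unfold locVar
  apply Finset.sum_le_sum_of_subset_of_nonneg
  · exact Finset.Icc_subset_Icc_right h
  · intro i _ _
    apply Real.sSup_nonneg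
    rintro _ ⟨x, _, rfl⟩
    exact abs_nonneg _

lemma interval_bound {E : Type*} [NormedAddCommGroup E] [NormedSpace ℝ E]
    (T : ℕ) (Ω : Set E) (hΩne : Ω.Nonempty) (hΩ : IsCompact Ω)
    (f : ℕ → E → ℝ) (hf : ∀ t ∈ Finset.Icc 1 T, ContinuousOn (f t) Ω)
    (w : ℕ → E) (s q : ℕ) (hs : 1 ≤ s) (hsq : s ≤ q) (hq : q ≤ T) :
    ∑ t ∈ Finset.Icc s q, (f t (w t) - sInf ((f t) '' Ω)) ≤
      statReg Ω f w s q + 2 * ((q - s + 1 : ℕ) : ℝ) * locVar Ω f s q := by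
  have hfc : ∀ t ∈ Finset.Icc s q, ContinuousOn (f t) Ω := by
    intro t ht
    rw [Finset.mem_Icc] at ht
    exact hf t (Finset.mem_Icc.2 ⟨by omega, by omega⟩)
  have hD : ∀ y ∈ Ω, ∀ t ∈ Finset.Icc s q, |f t y - f s y| ≤ locVar Ω f s q := by
    intro y hy t ht
    rw [Finset.mem_Icc] at ht
    exact (locVar_drift T Ω hΩ f hf s hs y hy t ht.1 (by omega)).trans
      (locVar_mono Ω f s t q ht.2)
  obtain ⟨x, hx, hmin⟩ := hΩ.exists_isMinOn hΩne (hfc s (Finset.mem_Icc.2 ⟨le_rfl, hsq⟩))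
  have hb : BddBelow ((fun x => ∑ t ∈ Finset.Icc s q, f t x) '' Ω) := by
    apply (hΩ.image_of_continuousOn _).bddBelow
    exact continuousOn_finset_sum _ hfc
  have h1 : sInf ((fun x => ∑ t ∈ Finset.Icc s q, f t x) '' Ω) ≤ ∑ t ∈ Finset.Icc s q, f t x :=
    csInf_le hb ⟨x, hx, rfl⟩
  have h2 : ∑ t ∈ Finset.Icc s q, f t x ≤
      ∑ t ∈ Finset.Icc s q, (sInf ((f t) '' Ω) + 2 * locVar Ω f s q) := by
    apply Finset.sum_le_sum
    intro t ht
    have h3 : f t x - 2 * locVar Ω f s q ≤ sInf ((f t) '' Ω) := by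
      apply le_csInf (hΩne.image _)
      rintro _ ⟨y, hy, rfl⟩
      have a := abs_le.1 (hD x hx t ht)
      have b := abs_le.1 (hD y hy t ht)
      have c : f s x ≤ f s y := hmin hy
      linarith [a.2, b.1]
    linarith
  rw [Finset.sum_add_distrib, Finset.sum_const, Nat.card_Icc, nsmul_eq_mul,
    show q + 1 - s = q - s + 1 by omega] at h2
  rw [Finset.sum_sub_distrib]
  unfold statReg
  linarith

/-- For every partition of `[1,T]` into consecutive intervals `I_i = [s_i, q_i]`,
`DReg* ≤ ∑_i ( (static regret of w on I_i) + 2 |I_i| V(s_i, q_i) )`. -/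
theorem dynamic_regret_le_interval_static_regret
    {E : Type*} [NormedAddCommGroup E] [NormedSpace ℝ E]
    (T : ℕ) (hT : 1 ≤ T) (Ω : Set E) (hΩne : Ω.Nonempty) (hΩ : IsCompact Ω)
    (f : ℕ → E → ℝ) (hf : ∀ t ∈ Finset.Icc 1 T, ContinuousOn (f t) Ω)
    (w : ℕ → E) (hw : ∀ t ∈ Finset.Icc 1 T, w t ∈ Ω)
    (k : ℕ) (hk : 1 ≤ k) (s q : ℕ → ℕ)
    (hs1 : s 1 = 1) (hqk : q k = T)
    (hcons : ∀ i ∈ Finset.Icc 1 (k - 1), q i + 1 = s (i + 1))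
    (hle : ∀ i ∈ Finset.Icc 1 k, s i ≤ q i) :
    DRegStar Ω f w T ≤
      ∑ i ∈ Finset.Icc 1 k,
        (statReg Ω f w (s i) (q i) +
          2 * ((q i - s i + 1 : ℕ) : ℝ) * locVar Ω f (s i) (q i)) := by
  have hs : ∀ i ∈ Finset.Icc 1 k, 1 ≤ s i := by
    intro i hi
    rw [Finset.mem_Icc] at hi
    rcases Nat.lt_or_ge 1 i with h | h
    · have := hcons (i - 1) (Finset.mem_Icc.2 ⟨by omega, by omega⟩)
      rw [Nat.sub_add_cancel hi.1] at this
      omega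
    · have : i = 1 := by omega
      subst this
      omega
  have hqm : ∀ i, 1 ≤ i → ∀ j, i ≤ j → j ≤ k → q i ≤ q j := by
    intro i hi j hij
    induction j, hij using Nat.le_induction with
    | base => intro _; exact le_rfl
    | succ n hn ih =>
      intro h
      have h1 := ih (by omega)
      have h2 := hcons n (Finset.mem_Icc.2 ⟨by omega, by omega⟩)
      have h3 := hle (n + 1) (Finset.mem_Icc.2 ⟨by omega, by omega⟩)
      omega
  have hpart : ∀ (g : ℕ → ℝ) (j : ℕ), 1 ≤ j → j ≤ k →
      ∑ t ∈ Finset.Icc 1 (q j), g t =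
        ∑ i ∈ Finset.Icc 1 j, ∑ t ∈ Finset.Icc (s i) (q i), g t := by
    intro g j hj
    induction j, hj using Nat.le_induction with
    | base => intro _; simp [hs1]
    | succ n hn ih =>
      intro h
      have h2 := hcons n (Finset.mem_Icc.2 ⟨by omega, by omega⟩)
      have h3 := hle (n + 1) (Finset.mem_Icc.2 ⟨by omega, by omega⟩)
      rw [Finset.sum_Icc_succ_top (by omega), ← ih (by omega), ← h2,
        ← Finset.sum_union]
      · congr 1
        ext t
        simp only [Finset.mem_Icc, Finset.mem_union]
        omega
      · rw [Finset.disjoint_left]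
        intro t
        simp only [Finset.mem_Icc]
        omega
  unfold DRegStar
  rw [← Finset.sum_sub_distrib, ← hqk, hpart _ k hk le_rfl]
  apply Finset.sum_le_sum
  intro i hi
  have hi' := Finset.mem_Icc.1 hi
  exact interval_bound T Ω hΩne hΩ f hf w (s i) (q i) (hs i hi) (hle i hi)
    (hqk ▸ hqm i hi'.1 k hi'.2 le_rfl)
end

section
/- For any interval [s,q] ⊆ [1,T], the gap between the best fixed decision and the per-round minimizers satisfies min_{w∈Ω} Σ_{t=s}^{q} f_t(w) − Σ_{t=s}^{q} min_{w∈Ω} f_t(w) ≤ 2·(q − s + 1)·V(s,q). -/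
/-- Each increment is bounded by the supremum, so `|f t x - f s x| ≤ V(s,t)`. -/
theorem abs_sub_le_locVar
    {E : Type*} [NormedAddCommGroup E] [NormedSpace ℝ E]
    (T : ℕ) (Ω : Set E) (hΩ : IsCompact Ω)
    (f : ℕ → E → ℝ) (hf : ∀ t ∈ Finset.Icc 1 T, ContinuousOn (f t) Ω)
    (s : ℕ) (hs : 1 ≤ s) (x : E) (hx : x ∈ Ω) (t : ℕ) (hst : s ≤ t) (htT : t ≤ T) :
    |f t x - f s x| ≤ locVar Ω f s t := by
  induction t, hst using Nat.le_induction with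
  | base => simp [locVar]
  | succ n hn ih =>
    have h1 := ih (by omega)
    have hc : ContinuousOn (fun x => |f (n + 1) x - f n x|) Ω :=
      ((hf (n + 1) (by simp; omega)).sub (hf n (by simp; omega))).abs
    have h2 : |f (n + 1) x - f n x| ≤ sSup ((fun x => |f (n + 1) x - f n x|) '' Ω) :=
      le_csSup (hΩ.bddAbove_image hc) ⟨x, hx, rfl⟩
    have h3 : locVar Ω f s (n + 1)
        = locVar Ω f s n + sSup ((fun x => |f (n + 1) x - f n x|) '' Ω) := by
      unfold locVar
      rw [Finset.sum_Icc_succ_top (by omega)]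
      simp
    rw [h3]
    have h4 := abs_sub_le (f (n + 1) x) (f n x) (f s x)
    linarith

/-- `V(s,·)` is monotone. -/
theorem locVar_mono_right
    {E : Type*} [NormedAddCommGroup E] [NormedSpace ℝ E]
    (Ω : Set E) (f : ℕ → E → ℝ) (s t q : ℕ) (htq : t ≤ q) :
    locVar Ω f s t ≤ locVar Ω f s q := by
  unfold locVar
  refine Finset.sum_le_sum_of_subset_of_nonneg (Finset.Icc_subset_Icc le_rfl htq) ?_
  intro i _ _
  apply Real.sSup_nonneg
  rintro _ ⟨y, _, rfl⟩
  exact abs_nonneg _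

/-- For any interval `[s,q] ⊆ [1,T]`, the gap between the best fixed decision and the
per-round minimizers is at most `2 (q−s+1) V(s,q)`. -/
theorem best_fixed_minus_per_round_min_le
    {E : Type*} [NormedAddCommGroup E] [NormedSpace ℝ E]
    (T : ℕ) (hT : 1 ≤ T) (Ω : Set E) (hΩne : Ω.Nonempty) (hΩ : IsCompact Ω)
    (f : ℕ → E → ℝ) (hf : ∀ t ∈ Finset.Icc 1 T, ContinuousOn (f t) Ω)
    (s q : ℕ) (hs : 1 ≤ s) (hsq : s ≤ q) (hqT : q ≤ T) :
    sInf ((fun x => ∑ t ∈ Finset.Icc s q, f t x) '' Ω)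
        - ∑ t ∈ Finset.Icc s q, sInf ((f t) '' Ω)
      ≤ 2 * ((q - s + 1 : ℕ) : ℝ) * locVar Ω f s q := by
  have hV : ∀ x ∈ Ω, ∀ t ∈ Finset.Icc s q, |f t x - f s x| ≤ locVar Ω f s q := by
    intro x hx t ht
    rw [Finset.mem_Icc] at ht
    exact (abs_sub_le_locVar T Ω hΩ f hf s hs x hx t ht.1 (by omega)).trans
      (locVar_mono_right Ω f s t q ht.2)
  obtain ⟨x0, hx0, hmin⟩ := hΩ.exists_isMinOn hΩne (hf s (by simp; omega))
  have hsum : ContinuousOn (fun x => ∑ t ∈ Finset.Icc s q, f t x) Ω :=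
    continuousOn_finsetSum _ fun t ht => hf t (by simp at ht ⊢; omega)
  have h1 : sInf ((fun x => ∑ t ∈ Finset.Icc s q, f t x) '' Ω)
      ≤ ∑ t ∈ Finset.Icc s q, f t x0 :=
    csInf_le (hΩ.bddBelow_image hsum) ⟨x0, hx0, rfl⟩
  have h2 : ∀ t ∈ Finset.Icc s q, f t x0 - sInf ((f t) '' Ω) ≤ 2 * locVar Ω f s q := by
    intro t ht
    have : f t x0 - 2 * locVar Ω f s q ≤ sInf ((f t) '' Ω) := by
      apply le_csInf (hΩne.image _)
      rintro _ ⟨y, hy, rfl⟩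
      have a := abs_le.1 (hV x0 hx0 t ht)
      have b := abs_le.1 (hV y hy t ht)
      have c : f s x0 ≤ f s y := hmin hy
      linarith [a.2, b.1]
    linarith
  have h3 := Finset.sum_le_card_nsmul _ _ _ h2
  rw [Finset.sum_sub_distrib, nsmul_eq_mul, Nat.card_Icc,
    show q + 1 - s = q - s + 1 by omega] at h3
  linarith
end

section
/- Let 1 ≤ s ≤ t ≤ T, let w_s* ∈ Ω be a minimizer of f_s over Ω and let w_t* ∈ Ω be a minimizer of f_t over Ω. Then f_t(w_s*) − f_t(w_t*) ≤ 2·V(s,t). -/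
/-- If `ws` minimizes `f_s` over `Ω` and `wt` minimizes `f_t` over `Ω`, with
`1 ≤ s ≤ t ≤ T`, then `f_t(ws) − f_t(wt) ≤ 2 V(s,t)`. -/
theorem minimizer_gap_le_two_locVar
    {E : Type*} [NormedAddCommGroup E] [NormedSpace ℝ E]
    (T : ℕ) (hT : 1 ≤ T) (Ω : Set E) (hΩne : Ω.Nonempty) (hΩ : IsCompact Ω)
    (f : ℕ → E → ℝ) (hf : ∀ t ∈ Finset.Icc 1 T, ContinuousOn (f t) Ω)
    (s t : ℕ) (hs : 1 ≤ s) (hst : s ≤ t) (htT : t ≤ T)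
    (ws wt : E) (hws : ws ∈ Ω) (hwt : wt ∈ Ω)
    (hwsmin : ∀ x ∈ Ω, f s ws ≤ f s x)
    (hwtmin : ∀ x ∈ Ω, f t wt ≤ f t x) :
    f t ws - f t wt ≤ 2 * locVar Ω f s t := by
  have key : ∀ x ∈ Ω, |f t x - f s x| ≤ locVar Ω f s t := by
    intro x hx
    clear hwtmin
    induction t, hst using Nat.le_induction with
    | base => simp [locVar]
    | succ n hn ih =>
      have h1 := ih (by omega)
      have h2 : locVar Ω f s (n + 1) = locVar Ω f s n
          + sSup ((fun x => |f (n + 1) x - f n x|) '' Ω) := by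
        unfold locVar
        rw [Finset.sum_Icc_succ_top (by omega)]
        simp
      have hc : ContinuousOn (fun x => |f (n + 1) x - f n x|) Ω :=
        ((hf (n + 1) (Finset.mem_Icc.2 ⟨by omega, htT⟩)).sub
          (hf n (Finset.mem_Icc.2 ⟨by omega, by omega⟩))).abs
      have h3 : |f (n + 1) x - f n x| ≤ sSup ((fun x => |f (n + 1) x - f n x|) '' Ω) :=
        le_csSup (hΩ.image_of_continuousOn hc).bddAbove ⟨x, hx, rfl⟩
      have h4 := abs_sub_le (f (n + 1) x) (f n x) (f s x)
      linarith
  have h1 := (abs_le.1 (key ws hws)).2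
  have h2 := (abs_le.1 (key wt hwt)).1
  have h3 := hwsmin wt hwt
  linarith
end

section
/- If there are at most k−1 indices t ∈ [2,T] with f_t ≠ f_{t−1}, then there exists a partition of {1,…,T} into at most k consecutive intervals I_1=[s_1,q_1], …, I_m=[s_m,q_m] (m ≤ k) such that V(s_i,q_i) = 0 for every i, and consequently DReg* ≤ Σ_{i=1}^m SAReg(T, |I_i|). -/
theorem partition_aux (P : ℕ → Prop) [DecidablePred P] (T : ℕ) (hT : 1 ≤ T) :
    ∃ (m : ℕ) (s q : ℕ → ℕ), 1 ≤ m ∧ m = ((Finset.Icc 2 T).filter P).card + 1 ∧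
      s 1 = 1 ∧ q m = T ∧
      (∀ i ∈ Finset.Icc 1 (m - 1), q i + 1 = s (i + 1)) ∧
      (∀ i ∈ Finset.Icc 1 m, 1 ≤ s i ∧ s i ≤ q i ∧ q i ≤ T) ∧
      (∀ i ∈ Finset.Icc 1 m, ∀ t ∈ Finset.Icc (s i + 1) (q i), ¬ P t) ∧
      (∀ g : ℕ → ℝ, ∑ t ∈ Finset.Icc 1 T, g t =
        ∑ i ∈ Finset.Icc 1 m, ∑ t ∈ Finset.Icc (s i) (q i), g t) := by
  induction T, hT using Nat.le_induction with
  | base => exact ⟨1, fun _ => 1, fun _ => 1, by simp⟩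
  | succ T hT ih =>
    obtain ⟨m, s, q, h1, hm, hs, hq, hc, hle, hP, hsum⟩ := ih
    have hI : Finset.Icc 2 (T + 1) = insert (T + 1) (Finset.Icc 2 T) := by
      ext x; simp only [Finset.mem_Icc, Finset.mem_insert]; omega
    have hnot : T + 1 ∉ (Finset.Icc 2 T).filter P := by simp
    simp only [Finset.mem_Icc] at hc hle hP
    by_cases hp : P (T + 1)
    · refine ⟨m + 1, Function.update s (m + 1) (T + 1), Function.update q (m + 1) (T + 1),
        by omega, ?_, ?_, by simp, ?_, ?_, ?_, ?_⟩
      · rw [hI, Finset.filter_insert, if_pos hp, Finset.card_insert_of_notMem hnot, ← hm]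
      · rw [Function.update_of_ne (by omega), hs]
      · intro i hi
        simp only [Finset.mem_Icc] at hi
        rw [Function.update_of_ne (by omega)]
        by_cases him : i = m
        · subst him; simp [hq]
        · rw [Function.update_of_ne (by omega)]; exact hc i (by omega)
      · intro i hi
        simp only [Finset.mem_Icc] at hi
        by_cases him : i = m + 1
        · subst him; simp
        · rw [Function.update_of_ne him, Function.update_of_ne him]
          have := hle i (by omega)
          omega
      · intro i hi t ht
        simp only [Finset.mem_Icc] at hi ht
        by_cases him : i = m + 1
        · subst him; simp at ht; omega
        · rw [Function.update_of_ne him, Function.update_of_ne him] at ht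
          exact hP i (by omega) t ht
      · intro g
        rw [Finset.sum_Icc_succ_top (by omega), Finset.sum_Icc_succ_top (by omega), hsum]
        congr 1
        · refine Finset.sum_congr rfl fun i hi => ?_
          simp only [Finset.mem_Icc] at hi
          rw [Function.update_of_ne (by omega), Function.update_of_ne (by omega)]
        · simp
    · refine ⟨m, s, Function.update q m (T + 1), h1, ?_, hs, by simp, ?_, ?_, ?_, ?_⟩
      · rw [hI, Finset.filter_insert, if_neg hp, ← hm]
      · intro i hi
        simp only [Finset.mem_Icc] at hi
        rw [Function.update_of_ne (by omega)]
        exact hc i hi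
      · intro i hi
        simp only [Finset.mem_Icc] at hi
        have := hle i hi
        by_cases him : i = m
        · subst him; simp; omega
        · rw [Function.update_of_ne him]
          omega
      · intro i hi t ht
        simp only [Finset.mem_Icc] at hi ht
        by_cases him : i = m
        · subst him
          simp at ht
          by_cases htT : t = T + 1
          · rw [htT]; exact hp
          · exact hP i hi t (by omega)
        · rw [Function.update_of_ne him] at ht
          exact hP i hi t ht
      · intro g
        obtain ⟨n, rfl⟩ : ∃ n, m = n + 1 := ⟨m - 1, by omega⟩
        have hl := hle (n + 1) (by omega)
        rw [Finset.sum_Icc_succ_top (by omega), hsum, Finset.sum_Icc_succ_top (by omega),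
          Finset.sum_Icc_succ_top (by omega)]
        rw [Function.update_self, Finset.sum_Icc_succ_top (by omega), hq, ← add_assoc]
        congr 2
        refine Finset.sum_congr rfl fun i hi => ?_
        simp only [Finset.mem_Icc] at hi
        rw [Function.update_of_ne (by omega)]

open scoped Classical in
/-- If the function sequence changes at most `k−1` times, then there is a partition of
`[1,T]` into at most `k` consecutive intervals on each of which the local functional
variation vanishes, and consequently `DReg* ≤ ∑_i SAReg(T, |I_i|)`. -/
theorem dynamic_regret_piecewise_stationary
    {E : Type*} [NormedAddCommGroup E] [NormedSpace ℝ E]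
    (T : ℕ) (hT : 1 ≤ T) (Ω : Set E) (hΩne : Ω.Nonempty) (hΩ : IsCompact Ω)
    (f : ℕ → E → ℝ) (hf : ∀ t ∈ Finset.Icc 1 T, ContinuousOn (f t) Ω)
    (w : ℕ → E) (hw : ∀ t ∈ Finset.Icc 1 T, w t ∈ Ω)
    (k : ℕ) (hk : 1 ≤ k)
    (hchanges :
      ((Finset.Icc 2 T).filter fun t => ¬ Set.EqOn (f t) (f (t - 1)) Ω).card ≤ k - 1) :
    ∃ (m : ℕ) (s q : ℕ → ℕ), 1 ≤ m ∧ m ≤ k ∧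
      s 1 = 1 ∧ q m = T ∧
      (∀ i ∈ Finset.Icc 1 (m - 1), q i + 1 = s (i + 1)) ∧
      (∀ i ∈ Finset.Icc 1 m, s i ≤ q i) ∧
      (∀ i ∈ Finset.Icc 1 m, locVar Ω f (s i) (q i) = 0) ∧
      DRegStar Ω f w T ≤ ∑ i ∈ Finset.Icc 1 m, SAReg Ω f w T (q i - s i + 1) := by
  obtain ⟨m, s, q, h1, hm, hs, hq, hc, hle, hP, hsum⟩ :=
    partition_aux (fun t => ¬ Set.EqOn (f t) (f (t - 1)) Ω) T hT
  simp only [not_not] at hP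
  refine ⟨m, s, q, h1, by omega, hs, hq, hc, fun i hi => (hle i hi).2.1, ?_, ?_⟩
  · intro i hi
    unfold locVar
    refine Finset.sum_eq_zero fun t ht => ?_
    have h := hP i hi t ht
    have : (fun x => |f t x - f (t - 1) x|) '' Ω = {0} := by
      rw [Set.image_congr (g := fun _ => (0 : ℝ)) (fun x hx => by simp [h hx]),
        hΩne.image_const]
    rw [this, csSup_singleton]
  · unfold DRegStar
    rw [hsum, hsum, ← Finset.sum_sub_distrib]
    refine Finset.sum_le_sum fun i hi => ?_
    obtain ⟨a1, a2, a3⟩ := hle i hi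
    have hSA : statReg Ω f w (s i) (q i) ≤ SAReg Ω f w T (q i - s i + 1) := by
      unfold SAReg
      refine le_csSup ((Set.finite_Icc _ _).image _).bddAbove ⟨s i, ⟨a1, by omega⟩, ?_⟩
      have : s i + (q i - s i + 1) - 1 = q i := by omega
      simp only [this]
    refine le_trans ?_ hSA
    unfold statReg
    have heq : ∀ t, s i ≤ t → t ≤ q i → Set.EqOn (f t) (f (s i)) Ω := by
      intro t ht
      induction t, ht using Nat.le_induction with
      | base => intro _ x _; rfl
      | succ t ht ih =>
        intro htq
        exact (hP i hi (t + 1) (Finset.mem_Icc.2 ⟨by omega, htq⟩)).trans (ih (by omega))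
    obtain ⟨x, hx, hmin⟩ := hΩ.exists_isMinOn hΩne
      (hf (s i) (Finset.mem_Icc.2 ⟨a1, by omega⟩))
    have hcont : ContinuousOn (fun x => ∑ t ∈ Finset.Icc (s i) (q i), f t x) Ω := by
      refine continuousOn_finsetSum _ fun t ht => hf t ?_
      simp only [Finset.mem_Icc] at ht ⊢
      omega
    have hinf := csInf_le (hΩ.bddBelow_image hcont) (Set.mem_image_of_mem _ hx)
    have hge : ∑ t ∈ Finset.Icc (s i) (q i), f t x ≤
        ∑ t ∈ Finset.Icc (s i) (q i), sInf (f t '' Ω) := by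
      refine Finset.sum_le_sum fun t ht => ?_
      simp only [Finset.mem_Icc] at ht
      have h := heq t ht.1 ht.2
      refine le_csInf (hΩne.image _) ?_
      rintro _ ⟨y, hy, rfl⟩
      rw [h hx, h hy]
      exact hmin hy
    linarith
end

section
/- Let Ω be a convex subset of a real finite-dimensional inner product space, let f be twice continuously differentiable on the whole space, let λ > 0 and G > 0. Assume f is λ-strongly convex on Ω, i.e., f(y) ≥ f(x) + ⟨∇f(x), y−x⟩ + (λ/2)‖y−x‖² for all x, y ∈ Ω, and ‖∇f(w)‖ ≤ G for all w ∈ Ω. Then f is (λ/G²)-exp-concave on Ω, i.e., the function w ↦ exp(−(λ/G²)·f(w)) is concave on Ω. -/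
open scoped RealInnerProductSpace

/-- A `λ`-strongly convex function with gradients bounded by `G` on a convex set `Ω`
is `λ/G²`-exp-concave on `Ω`. -/
theorem strongly_convex_bounded_gradient_expConcave
    {E : Type*} [NormedAddCommGroup E] [InnerProductSpace ℝ E] [FiniteDimensional ℝ E]
    (Ω : Set E) (hΩ : Convex ℝ Ω) (f : E → ℝ) (hf : ContDiff ℝ 2 f)
    (lam G : ℝ) (hlam : 0 < lam) (hG : 0 < G)
    (hsc : ∀ x ∈ Ω, ∀ y ∈ Ω,
      f x + ⟪gradient f x, y - x⟫ + lam / 2 * ‖y - x‖ ^ 2 ≤ f y)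
    (hgrad : ∀ x ∈ Ω, ‖gradient f x‖ ≤ G) :
    ConcaveOn ℝ Ω (fun x => Real.exp (-(lam / G ^ 2) * f x)) := by
  refine ⟨hΩ, ?_⟩
  intro x hx y hy a b ha hb hab
  set v := y - x with hv
  set p : ℝ → E := fun t => x + t • v with hp
  have hpΩ : ∀ t ∈ Set.Icc (0:ℝ) 1, p t ∈ Ω := by
    intro t ht
    have := hΩ hx hy (a := 1 - t) (b := t) (by linarith [ht.2]) ht.1 (by ring)
    convert this using 1
    simp only [hp, hv]
    module
  have hpd : ∀ t, HasDerivAt p v t := by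
    intro t
    have := ((hasDerivAt_id t).smul_const v).const_add x
    simpa [hp] using this
  have hgr : ∀ z w, ⟪gradient f z, w⟫ = fderiv ℝ f z w := by
    intro z w
    simp [gradient]
  set g : ℝ → ℝ := fun t => f (p t) with hgdef
  set φ : ℝ → ℝ := fun t => fderiv ℝ f (p t) v with hφ
  have hgd : ∀ t, HasDerivAt g (φ t) t := by
    intro t
    exact ((hf.differentiable (by norm_num)) (p t)).hasFDerivAt.comp_hasDerivAt t (hpd t)
  have hφdiff : Differentiable ℝ φ := by
    intro t
    have h1 : Differentiable ℝ (fderiv ℝ f) :=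
      (hf.fderiv_right (m := 1) (by norm_num)).differentiable (by norm_num)
    have h2 : DifferentiableAt ℝ (fun t => fderiv ℝ f (p t)) t :=
      (h1 (p t)).comp t (hpd t).differentiableAt
    exact h2.clm_apply (differentiableAt_const v)
  have hmono : MonotoneOn (fun t => φ t - lam * ‖v‖ ^ 2 * t) (Set.Icc (0:ℝ) 1) := by
    intro s hs t ht hst
    rcases hst.eq_or_lt with rfl | hlt
    · exact le_rfl
    have h1 := hsc _ (hpΩ s hs) _ (hpΩ t ht)
    have h2 := hsc _ (hpΩ t ht) _ (hpΩ s hs)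
    have e1 : p t - p s = (t - s) • v := by simp only [hp]; module
    have e2 : p s - p t = (s - t) • v := by simp only [hp]; module
    rw [hgr, e1, map_smul, norm_smul, mul_pow, Real.norm_eq_abs, sq_abs, smul_eq_mul] at h1
    rw [hgr, e2, map_smul, norm_smul, mul_pow, Real.norm_eq_abs, sq_abs, smul_eq_mul] at h2
    have h3 : 0 ≤ (t - s) * ((φ t - lam * ‖v‖ ^ 2 * t) - (φ s - lam * ‖v‖ ^ 2 * s)) := by
      simp only [hφ]
      nlinarith
    have := nonneg_of_mul_nonneg_right h3 (sub_pos.2 hlt)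
    simp only
    linarith
  have hφ' : ∀ t ∈ Set.Ioo (0:ℝ) 1, lam * ‖v‖ ^ 2 ≤ deriv φ t := by
    intro t ht
    have h1 : 0 ≤ derivWithin (fun t => φ t - lam * ‖v‖ ^ 2 * t) (Set.Icc (0:ℝ) 1) t :=
      hmono.derivWithin_nonneg
    rw [derivWithin_of_mem_nhds (Icc_mem_nhds ht.1 ht.2)] at h1
    have h2 := ((hφdiff t).hasDerivAt.sub ((hasDerivAt_id t).const_mul (lam * ‖v‖ ^ 2))).deriv
    have h3 : deriv (fun t => φ t - lam * ‖v‖ ^ 2 * t) t = deriv φ t - lam * ‖v‖ ^ 2 * 1 := h2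
    rw [h3] at h1
    linarith
  have hφb : ∀ t ∈ Set.Icc (0:ℝ) 1, φ t ^ 2 ≤ G ^ 2 * ‖v‖ ^ 2 := by
    intro t ht
    have h1 : |φ t| ≤ G * ‖v‖ := by
      have := abs_real_inner_le_norm (gradient f (p t)) v
      rw [hgr] at this
      exact this.trans (mul_le_mul_of_nonneg_right (hgrad _ (hpΩ t ht)) (norm_nonneg _))
    rw [← mul_pow, ← sq_abs]
    exact pow_le_pow_left₀ (abs_nonneg _) h1 2
  set α := lam / G ^ 2 with hα
  have hαpos : 0 < α := by positivity
  have hαG : α * G ^ 2 = lam := by rw [hα]; field_simp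
  have hd1 : ∀ t, HasDerivAt (fun t => Real.exp (-α * g t))
      (Real.exp (-α * g t) * (-α * φ t)) t := fun t => ((hgd t).const_mul (-α)).exp
  have hd2 : ∀ t, HasDerivAt (fun t => Real.exp (-α * g t) * (-α * φ t))
      (Real.exp (-α * g t) * (-α * φ t) * (-α * φ t)
        + Real.exp (-α * g t) * (-α * deriv φ t)) t :=
    fun t => (hd1 t).mul ((hφdiff t).hasDerivAt.const_mul (-α))
  have hconc : ConcaveOn ℝ (Set.Icc (0:ℝ) 1) (fun t => Real.exp (-α * g t)) := by
    refine concaveOn_of_hasDerivWithinAt2_nonpos (convex_Icc 0 1)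
      (fun t _ => (hd1 t).continuousAt.continuousWithinAt)
      (fun t _ => (hd1 t).hasDerivWithinAt) (fun t _ => (hd2 t).hasDerivWithinAt) ?_
    intro t ht
    rw [interior_Icc] at ht
    have h1 := hφ' t ht
    have h2 := hφb t (Set.Ioo_subset_Icc_self ht)
    have h3 : α * φ t ^ 2 ≤ deriv φ t := by
      have := mul_le_mul_of_nonneg_left h2 hαpos.le
      rw [← mul_assoc, hαG] at this
      linarith
    have h4 : 0 ≤ Real.exp (-α * g t) * (α * (deriv φ t - α * φ t ^ 2)) :=
      mul_nonneg (Real.exp_pos _).le (mul_nonneg hαpos.le (by linarith))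
    linarith
  have key := hconc.2 (x := 0) (by simp) (y := 1) (by simp) ha hb hab
  have e0 : p 0 = x := by simp [hp]
  have e1 : p 1 = y := by simp [hp, hv]
  have e2 : p (a • (0:ℝ) + b • (1:ℝ)) = a • x + b • y := by
    obtain rfl : a = 1 - b := by linarith
    simp only [hp, hv, smul_eq_mul]
    module
  simp only [hgdef, e0, e1, e2] at key
  exact key
end

section
/- Let Ω be an open convex subset of a real finite-dimensional inner product space, let f be twice continuously differentiable on Ω, and let α > 0. If for every w ∈ Ω and every direction v one has α·⟨∇f(w), v⟩² ≤ D²f(w)[v,v], where D²f(w)[v,v] denotes the second derivative (Hessian) quadratic form of f at w evaluated at v, then f is α-exp-concave on Ω, i.e., the function w ↦ exp(−α f(w)) is concave on Ω. -/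
open scoped RealInnerProductSpace

/-- If `f` is twice continuously differentiable on an open convex set `Ω` and
`α ⟨∇f(w), v⟩² ≤ D²f(w)[v,v]` for all `w ∈ Ω` and all directions `v`, then `f` is
`α`-exp-concave on `Ω`, i.e. `w ↦ exp(−α f(w))` is concave on `Ω`. -/
theorem hessian_dominates_gradient_sq_expConcave
    {E : Type*} [NormedAddCommGroup E] [InnerProductSpace ℝ E] [FiniteDimensional ℝ E]
    (Ω : Set E) (hΩo : IsOpen Ω) (hΩ : Convex ℝ Ω) (f : E → ℝ)
    (hf : ContDiffOn ℝ 2 f Ω) (α : ℝ) (hα : 0 < α)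
    (hdom : ∀ w ∈ Ω, ∀ v : E,
      α * ⟪gradient f w, v⟫ ^ 2 ≤ iteratedFDeriv ℝ 2 f w ![v, v]) :
    ConcaveOn ℝ Ω (fun w => Real.exp (-α * f w)) := by
  refine ⟨hΩ, ?_⟩
  intro x hx y hy a b ha hb hab
  set v : E := y - x with hv
  have hmem : ∀ t ∈ Set.Icc (0 : ℝ) 1, x + t • v ∈ Ω := by
    intro t ht
    exact hΩ.add_smul_sub_mem hx hy ht
  have hline : ∀ t : ℝ, HasDerivAt (fun t : ℝ => x + t • v) v t := by
    intro t
    simpa using ((hasDerivAt_id t).smul_const v).const_add x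
  have hd1 : ∀ t ∈ Set.Icc (0 : ℝ) 1,
      HasDerivAt (fun t : ℝ => f (x + t • v)) (fderiv ℝ f (x + t • v) v) t := by
    intro t ht
    have h1 : DifferentiableAt ℝ f (x + t • v) :=
      (hf.contDiffAt (hΩo.mem_nhds (hmem t ht))).differentiableAt (by norm_num)
    exact h1.hasFDerivAt.comp_hasDerivAt t (hline t)
  have hd2 : ∀ t ∈ Set.Icc (0 : ℝ) 1,
      HasDerivAt (fun t : ℝ => fderiv ℝ f (x + t • v) v)
        (fderiv ℝ (fderiv ℝ f) (x + t • v) v v) t := by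
    intro t ht
    have h1 : DifferentiableAt ℝ (fderiv ℝ f) (x + t • v) :=
      ((hf.contDiffAt (hΩo.mem_nhds (hmem t ht))).fderiv_right (m := 1)
        (by norm_num)).differentiableAt (by norm_num)
    have h2 := h1.hasFDerivAt.comp_hasDerivAt t (hline t)
    simpa using h2.clm_apply (hasDerivAt_const t v)
  have he1 : ∀ t ∈ Set.Icc (0 : ℝ) 1,
      HasDerivAt (fun t : ℝ => Real.exp (-α * f (x + t • v)))
        (Real.exp (-α * f (x + t • v)) * (-α * fderiv ℝ f (x + t • v) v)) t := by
    intro t ht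
    exact ((hd1 t ht).const_mul (-α)).exp
  have hconc : ConcaveOn ℝ (Set.Icc (0 : ℝ) 1)
      (fun t : ℝ => Real.exp (-α * f (x + t • v))) := by
    refine concaveOn_of_hasDerivWithinAt2_nonpos (convex_Icc 0 1)
      (fun t ht => (he1 t ht).continuousAt.continuousWithinAt)
      (fun t ht => (he1 t (interior_subset ht)).hasDerivWithinAt)
      (fun t ht => ((he1 t (interior_subset ht)).mul
        ((hd2 t (interior_subset ht)).const_mul (-α))).hasDerivWithinAt) ?_
    intro t ht
    have h := hdom _ (hmem t (interior_subset ht)) v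
    rw [iteratedFDeriv_two_apply] at h
    have hg : ⟪gradient f (x + t • v), v⟫ = fderiv ℝ f (x + t • v) v := by
      simp [gradient]
    rw [hg] at h
    simp only [Matrix.cons_val_zero, Matrix.cons_val_one] at h
    have hp : 0 < Real.exp (-α * f (x + t • v)) * α := by positivity
    have := mul_le_mul_of_nonneg_left h hp.le
    linarith
  have key := hconc.2 (Set.left_mem_Icc.2 zero_le_one) (Set.right_mem_Icc.2 zero_le_one) ha hb hab
  have hpt : x + b • v = a • x + b • y := by
    obtain rfl : a = 1 - b := by linarith
    rw [hv]
    module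
  have hxy : x + v = y := by rw [hv]; abel
  simpa [hpt, hxy] using key
end

section
/- For every integer K ≥ 2 and every integer t ≥ 1, the number of indices j with 1 ≤ j ≤ t that are alive at time t, i.e., the cardinality of {j : 1 ≤ j ≤ t and t < E_K(j)}, is at most (⌊log_K t⌋ + 1)·(K − 1). -/
/-- `kOfExp K t` is the largest `k` such that `K^k` divides `t` (for `K ≥ 2`, `t ≥ 1`). -/
def kOfExp (K t : ℕ) : ℕ := Nat.findGreatest (fun k => K ^ k ∣ t) t

/-- The base-`K` ending time: set the lowest nonzero base-`K` digit of `t` to `0` and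
add `1` to the digit one position higher, i.e.
`E_K(t) = K^(k(t)+1) · (⌊t / K^(k(t)+1)⌋ + 1)`. -/
def endK (K t : ℕ) : ℕ := K ^ (kOfExp K t + 1) * (t / K ^ (kOfExp K t + 1) + 1)

theorem kOfExp_dvd (K j : ℕ) : K ^ kOfExp K j ∣ j := by
  have h := Nat.findGreatest_spec (P := fun k => K ^ k ∣ j) (m := 0) (n := j) (Nat.zero_le _)
    (by simp)
  exact h

theorem kOfExp_not_dvd (K j : ℕ) (hK : 2 ≤ K) (hj : 1 ≤ j) : ¬ K ^ (kOfExp K j + 1) ∣ j := by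
  intro h
  have h1 : kOfExp K j + 1 < K ^ (kOfExp K j + 1) := Nat.lt_pow_self hK
  have h2 := Nat.le_of_dvd hj h
  have h3 : kOfExp K j + 1 ≤ kOfExp K j :=
    Nat.le_findGreatest (P := fun k => K ^ k ∣ j) (by omega) h
  omega

theorem alive_eq (K t j : ℕ) (hK : 2 ≤ K) (hjt : j ≤ t) (h : t < endK K j) :
    j = K ^ kOfExp K j * (K * (t / K ^ (kOfExp K j + 1)) + j / K ^ kOfExp K j % K) := by
  have hdiv : t / K ^ (kOfExp K j + 1) = j / K ^ (kOfExp K j + 1) := by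
    apply le_antisymm
    · apply Nat.le_of_lt_succ
      rw [Nat.div_lt_iff_lt_mul (by positivity), mul_comm]
      exact h
    · exact Nat.div_le_div_right hjt
  rw [hdiv, pow_succ, ← Nat.div_div_eq_div_mul, Nat.div_add_mod]
  exact (Nat.mul_div_cancel' (kOfExp_dvd K j)).symm

/-- The number of indices `j ∈ [1,t]` alive at time `t` (i.e. with `t < E_K(j)`) is at
most `(⌊log_K t⌋ + 1)(K − 1)`. -/
theorem card_alive_le (K t : ℕ) (hK : 2 ≤ K) (ht : 1 ≤ t) :
    ((Finset.Icc 1 t).filter fun j => t < endK K j).card ≤ (Nat.log K t + 1) * (K - 1) := by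
  have hcard : (Finset.range (Nat.log K t + 1) ×ˢ Finset.Icc 1 (K - 1)).card
      = (Nat.log K t + 1) * (K - 1) := by simp
  rw [← hcard]
  apply Finset.card_le_card_of_injOn (fun j => (kOfExp K j, j / K ^ kOfExp K j % K))
  · intro j hj
    simp only [Finset.coe_filter, Finset.mem_Icc, Set.mem_setOf_eq] at hj
    obtain ⟨⟨h1, h2⟩, h3⟩ := hj
    simp only [Finset.coe_product, Set.mem_prod, Finset.mem_coe, Finset.mem_range, Finset.mem_Icc]
    have hlt : j / K ^ kOfExp K j % K < K := Nat.mod_lt _ (by omega)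
    refine ⟨?_, ?_, by omega⟩
    · apply Nat.lt_succ_of_le
      apply Nat.le_log_of_pow_le (by omega)
      exact (Nat.le_of_dvd h1 (kOfExp_dvd K j)).trans h2
    · by_contra h0
      have h0 : j / K ^ kOfExp K j % K = 0 := by omega
      apply kOfExp_not_dvd K j hK h1
      rw [pow_succ]
      have := Nat.mul_dvd_mul_left (K ^ kOfExp K j) (Nat.dvd_of_mod_eq_zero h0)
      rwa [Nat.mul_div_cancel' (kOfExp_dvd K j)] at this
  · intro i hi j hj hij
    simp only [Finset.coe_filter, Finset.mem_Icc, Set.mem_setOf_eq] at hi hj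
    simp only [Prod.mk.injEq] at hij
    rw [alive_eq K t i hK hi.1.2 hi.2, alive_eq K t j hK hj.1.2 hj.2, hij.2, hij.1]
end

section
/- Fix integers K ≥ 2 and t ≥ 1, and let α_i = ⌊t / K^i⌋ mod K denote the i-th base-K digit of t. An index j with 1 ≤ j ≤ t satisfies t < E_K(j) if and only if there exist an integer i ≥ 0 and an integer β with 1 ≤ β ≤ α_i such that j = K^{i+1}·⌊t / K^{i+1}⌋ + β·K^i. -/
theorem kOfExp_of (K j i : ℕ) (hK : 2 ≤ K) (hj : 1 ≤ j) (h1 : K ^ i ∣ j)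
    (h2 : ¬ K ^ (i + 1) ∣ j) : kOfExp K j = i := by
  unfold kOfExp
  rw [Nat.findGreatest_eq_iff]
  refine ⟨?_, fun _ => h1, ?_⟩
  · exact (Nat.lt_pow_self (by omega : 1 < K)).le.trans (Nat.le_of_dvd hj h1)
  · intro n hn _ h
    exact h2 ((pow_dvd_pow K hn).trans h)

/-- Characterization of the alive indices: `j ∈ [1,t]` satisfies `t < E_K(j)` iff
`j = K^(i+1)·⌊t/K^(i+1)⌋ + β·K^i` for some `i ≥ 0` and some `β` with
`1 ≤ β ≤ α_i`, where `α_i = ⌊t/K^i⌋ mod K` is the `i`-th base-`K` digit of `t`. -/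
theorem alive_iff (K t : ℕ) (hK : 2 ≤ K) (ht : 1 ≤ t)
    (j : ℕ) (hj1 : 1 ≤ j) (hjt : j ≤ t) :
    t < endK K j ↔
      ∃ (i β : ℕ), 1 ≤ β ∧ β ≤ t / K ^ i % K ∧
        j = K ^ (i + 1) * (t / K ^ (i + 1)) + β * K ^ i := by
  constructor
  · intro h
    have h1 := kOfExp_dvd K j
    have h2 := kOfExp_not_dvd K j hK hj1
    unfold endK at h
    generalize kOfExp K j = i at *
    have hp : 0 < K ^ i := by positivity
    have hp1 : 0 < K ^ (i + 1) := by positivity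
    have hq : t / K ^ (i + 1) = j / K ^ (i + 1) := by
      apply le_antisymm
      · exact Nat.lt_succ_iff.mp (Nat.div_lt_of_lt_mul h)
      · exact Nat.div_le_div_right hjt
    obtain ⟨m, rfl⟩ := h1
    have hjq : K ^ i * m / K ^ (i + 1) = m / K := by
      rw [pow_succ, Nat.mul_div_mul_left _ _ hp]
    have htq : t / K ^ i / K = m / K := by
      rw [Nat.div_div_eq_div_mul, ← pow_succ, hq, hjq]
    have hm : m ≤ t / K ^ i := by
      rw [Nat.le_div_iff_mul_le hp, mul_comm]; exact hjt
    have e1 := Nat.div_add_mod m K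
    have e2 := Nat.div_add_mod (t / K ^ i) K
    rw [htq] at e2
    refine ⟨i, m % K, ?_, by omega, ?_⟩
    · by_contra h0
      apply h2
      rw [pow_succ]
      exact Nat.mul_dvd_mul_left _ (Nat.dvd_of_mod_eq_zero (by omega))
    · rw [hq, hjq]
      nth_rewrite 1 [← e1]
      ring
  · rintro ⟨i, β, hb1, hb2, hj⟩
    have hp : 0 < K ^ i := by positivity
    have hp1 : 0 < K ^ (i + 1) := by positivity
    have hbK : β < K := hb2.trans_lt (Nat.mod_lt _ (by omega))
    have hlt : β * K ^ i < K ^ (i + 1) := by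
      rw [pow_succ, mul_comm]; exact Nat.mul_lt_mul_of_pos_left hbK hp
    have hpos : 0 < β * K ^ i := by positivity
    have hk : kOfExp K j = i := by
      apply kOfExp_of K j i hK hj1
      · rw [hj]
        exact dvd_add ((pow_dvd_pow K (Nat.le_succ i)).mul_right _) (dvd_mul_left _ _)
      · rw [hj, Nat.dvd_add_right (dvd_mul_right _ _)]
        exact Nat.not_dvd_of_pos_of_lt hpos hlt
    have hd : j / K ^ (i + 1) = t / K ^ (i + 1) := by
      nth_rewrite 1 [hj]
      rw [Nat.mul_add_div hp1, Nat.div_eq_of_lt hlt, add_zero]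
    unfold endK
    rw [hk, hd]
    exact Nat.lt_mul_div_succ t hp1
end

section
/- For every integer K ≥ 2 and all integers 1 ≤ r ≤ s, there exist an integer m with 1 ≤ m ≤ ⌊log_K s⌋ + 1 and indices t_1, …, t_m such that t_1 = r, t_{j+1} = E_K(t_j) for all 1 ≤ j ≤ m−1, t_j ≤ s for all j, and E_K(t_m) > s. Consequently the consecutive intervals [t_j, E_K(t_j) − 1], j = 1, …, m, cover the interval [r, s]. -/
theorem endK_gt (K t : ℕ) (hK : 2 ≤ K) : t < endK K t :=
  Nat.lt_mul_div_succ t (Nat.pow_pos (by omega))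

theorem pow_dvd_endK (K t n : ℕ) (hK : 2 ≤ K) (ht : 1 ≤ t) (h : K ^ n ∣ t) :
    K ^ (n + 1) ∣ endK K t := by
  have h1 : n < K ^ n := Nat.lt_pow_self (by omega)
  have h2 : K ^ n ≤ t := Nat.le_of_dvd ht h
  have h3 : n ≤ kOfExp K t := Nat.le_findGreatest (by omega) h
  exact Dvd.dvd.mul_right (pow_dvd_pow K (by omega)) _

theorem chain_cover (T : ℕ → ℕ) (x : ℕ) (h0 : T 0 ≤ x) (n : ℕ) (hn : x < T n) :
    ∃ j < n, T j ≤ x ∧ x < T (j + 1) := by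
  induction n with
  | zero => omega
  | succ n ih =>
    by_cases h : x < T n
    · obtain ⟨j, hj, h'⟩ := ih h
      exact ⟨j, by omega, h'⟩
    · exact ⟨n, by omega, by omega, hn⟩

/-- For `1 ≤ r ≤ s` there are `m ≤ ⌊log_K s⌋ + 1` chained indices `t_1 = r`,
`t_{j+1} = E_K(t_j)`, all `≤ s`, with `E_K(t_m) > s`; consequently the consecutive
intervals `[t_j, E_K(t_j) − 1]` cover `[r, s]`. -/
theorem segments_cover (K r s : ℕ) (hK : 2 ≤ K) (hr : 1 ≤ r) (hrs : r ≤ s) :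
    ∃ (m : ℕ) (t : ℕ → ℕ), 1 ≤ m ∧ m ≤ Nat.log K s + 1 ∧
      t 1 = r ∧
      (∀ j ∈ Finset.Icc 1 (m - 1), t (j + 1) = endK K (t j)) ∧
      (∀ j ∈ Finset.Icc 1 m, t j ≤ s) ∧
      s < endK K (t m) ∧
      Set.Icc r s ⊆ ⋃ j ∈ Set.Icc 1 m, Set.Icc (t j) (endK K (t j) - 1) := by
  classical
  set T : ℕ → ℕ := fun n => (endK K)^[n] r with hT
  have hT0 : T 0 = r := rfl
  have hTs : ∀ n, T (n + 1) = endK K (T n) := fun n => Function.iterate_succ_apply' _ _ _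
  have hgrow : ∀ n, n + 1 ≤ T n := by
    intro n
    induction n with
    | zero => omega
    | succ n ih =>
      have := endK_gt K (T n) hK
      rw [hTs]
      omega
  have hdvd : ∀ n, K ^ n ∣ T n := by
    intro n
    induction n with
    | zero => simp
    | succ n ih =>
      rw [hTs]
      exact pow_dvd_endK K _ n hK (by have := hgrow n; omega) ih
  have hex : ∃ n, s < T n := ⟨s, by have := hgrow s; omega⟩
  obtain ⟨m, hm, hmin⟩ : ∃ m, s < T m ∧ ∀ j < m, T j ≤ s :=
    ⟨Nat.find hex, Nat.find_spec hex, fun j hj => not_lt.mp (Nat.find_min hex hj)⟩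
  have hm1 : 1 ≤ m := by
    rcases Nat.eq_zero_or_pos m with h | h
    · subst h
      omega
    · exact h
  have hpow : K ^ (m - 1) ≤ s :=
    (Nat.le_of_dvd (by have := hgrow (m - 1); omega) (hdvd (m - 1))).trans
      (hmin (m - 1) (by omega))
  have hlog : m - 1 ≤ Nat.log K s := Nat.le_log_of_pow_le (by omega) hpow
  refine ⟨m, fun j => T (j - 1), hm1, by omega, hT0, ?_, ?_, ?_, ?_⟩
  · intro j hj
    rw [Finset.mem_Icc] at hj
    have h := hTs (j - 1)
    rw [Nat.sub_add_cancel hj.1] at h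
    exact h
  · intro j hj
    rw [Finset.mem_Icc] at hj
    exact hmin (j - 1) (by omega)
  · have h := hTs (m - 1)
    rw [Nat.sub_add_cancel hm1] at h
    show s < endK K (T (m - 1))
    omega
  · intro x hx
    obtain ⟨hx1, hx2⟩ := hx
    obtain ⟨j, hj, h1, h2⟩ := chain_cover T x (by omega) m (by omega)
    rw [hTs] at h2
    simp only [Set.mem_iUnion]
    refine ⟨j + 1, ⟨by omega, by omega⟩, ?_⟩
    show T j ≤ x ∧ x ≤ endK K (T j) - 1
    omega
end

section
/- Let T ≥ 3 be a real number, let a ≥ 0 and b ≥ 0, and let V be a real number with 0 ≤ V ≤ T. Then there exists a real number τ with 1 ≤ τ ≤ T such that (a + b·ln T)·T/τ + 2·τ·V ≤ max{ a + (b + 2)·ln T , a·√(T·V/ln T) + (b + 2)·√(T·V·ln T) }. -/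
open Real

/-- The optimization over the interval length `τ` in the dynamic regret bounds for
exp-concave and strongly convex functions: some `τ ∈ [1, T]` makes
`(a + b ln T) T/τ + 2 τ V` at most
`max{ a + (b + 2) ln T , a √(T V / ln T) + (b + 2) √(T V ln T) }`. -/
theorem exists_tau_expconcave_bound (T a b V : ℝ) (hT : 3 ≤ T) (ha : 0 ≤ a)
    (hb : 0 ≤ b) (hV0 : 0 ≤ V) (hVT : V ≤ T) :
    ∃ τ : ℝ, 1 ≤ τ ∧ τ ≤ T ∧
      (a + b * Real.log T) * T / τ + 2 * τ * V ≤
        max (a + (b + 2) * Real.log T)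
          (a * Real.sqrt (T * V / Real.log T) + (b + 2) * Real.sqrt (T * V * Real.log T)) := by
  have hT0 : 0 < T := by linarith
  have hL : 1 ≤ Real.log T := by
    rw [Real.le_log_iff_exp_le hT0]
    have := Real.exp_one_lt_d9
    linarith
  generalize Real.log T = L at *
  have hL0 : 0 < L := by linarith
  by_cases hV : L ≤ T * V
  · have hVp : 0 < V := by
      by_contra h
      have : V = 0 := by linarith
      subst this
      linarith [mul_zero T]
    refine ⟨Real.sqrt (T * L / V), ?_, ?_, le_trans (le_of_eq ?_) (le_max_right _ _)⟩
    · rw [Real.one_le_sqrt, le_div_iff₀ hVp]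
      nlinarith
    · rw [Real.sqrt_le_left hT0.le, div_le_iff₀ hVp]
      nlinarith
    · rw [Real.sqrt_div (by positivity), Real.sqrt_div (by positivity), Real.sqrt_mul (by positivity),
        Real.sqrt_mul (by positivity), Real.sqrt_mul (by positivity)]
      have h1 := Real.sq_sqrt hT0.le
      have h2 := Real.sq_sqrt hVp.le
      have h3 := Real.sq_sqrt hL0.le
      have p1 := Real.sqrt_pos.2 hT0
      have p2 := Real.sqrt_pos.2 hVp
      have p3 := Real.sqrt_pos.2 hL0
      generalize Real.sqrt T = t at *
      generalize Real.sqrt V = v at *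
      generalize Real.sqrt L = l at *
      subst h1 h2 h3
      rw [Real.sqrt_mul (by positivity), Real.sqrt_sq p1.le, Real.sqrt_sq p2.le] 
      field_simp
      ring
  · refine ⟨T, by linarith, le_rfl, le_trans ?_ (le_max_left _ _)⟩
    rw [mul_div_assoc, div_self hT0.ne']
    nlinarith
end
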